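/- For every natural number n ≥ 1, the counting functions satisfy DiagP(x) ∼ P_n^T(x) as x → ∞; that is, the ratio DiagP(x) / P_n^T(x) tends to 1 as x → ∞. -/

import Mathlib

open Real Filter

/-- `nthPrime n` is the `n`-th prime number, 1-indexed: `nthPrime 1 = 2`, `nthPrime 2 = 3`, … -/
noncomputable def nthPrime (n : ℕ) : ℕ := Nat.nth Nat.Prime (n - 1)

/-- `iterPrime n k` is the `k`-fold iterated prime `p_n^(k)`:
`iterPrime n 0 = n`, `iterPrime n 1 = p_n`, and `iterPrime n (k+1) = p_{iterPrime n k}`. -/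
noncomputable def iterPrime (n : ℕ) : ℕ → ℕ
  | 0 => n
  | k + 1 => nthPrime (iterPrime n k)

/-- The counting function `P_n^T(x) = #{k ≥ 1 : p_n^(k) ≤ x}`. -/
noncomputable def PnT (n : ℕ) (x : ℝ) : ℕ :=
  {k : ℕ | 1 ≤ k ∧ (iterPrime n k : ℝ) ≤ x}.ncard

/-- The counting function `DiagP(x) = #{k ≥ 1 : p_k^(k) ≤ x}`. -/
noncomputable def DiagP (x : ℝ) : ℕ :=
  {k : ℕ | 1 ≤ k ∧ (iterPrime k k : ℝ) ≤ x}.ncard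

lemma monotone_nthPrime : Monotone nthPrime := fun _ _ h =>
  Nat.nth_monotone Nat.infinite_setOfPred_prime (Nat.sub_le_sub_right h 1)

lemma lt_nthPrime (n : ℕ) : n < nthPrime n := by
  have := Nat.add_two_le_nth_prime (n - 1)
  unfold nthPrime
  omega

lemma two_mul_add_one_le_nth_prime (i : ℕ) : 2 * i + 1 ≤ Nat.nth Nat.Prime i := by
  induction i with
  | zero => simp [Nat.nth_prime_zero_eq_two]
  | succ i ih =>
    have hlt : Nat.nth Nat.Prime i < Nat.nth Nat.Prime (i + 1) :=
      Nat.nth_strictMono Nat.infinite_setOfPred_prime i.lt_succ_self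
    have hge := Nat.add_two_le_nth_prime (i + 1)
    obtain ⟨c, hc⟩ := (Nat.prime_nth_prime (i + 1)).odd_of_ne_two (by omega)
    omega

lemma two_mul_le_nthPrime_add_one (n : ℕ) : 2 * n ≤ nthPrime n + 1 := by
  have := two_mul_add_one_le_nth_prime (n - 1)
  unfold nthPrime
  omega

lemma strictMono_iterPrime (n : ℕ) : StrictMono (iterPrime n) :=
  strictMono_nat_of_lt_succ fun _ => lt_nthPrime _

lemma iterPrime_mono_left (k : ℕ) : Monotone fun n => iterPrime n k := by
  induction k with
  | zero => exact monotone_id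
  | succ k ih => exact monotone_nthPrime.comp ih

lemma strictMono_iterPrime_diag : StrictMono fun k => iterPrime k k :=
  strictMono_nat_of_lt_succ fun k =>
    (iterPrime_mono_left k k.le_succ).trans_lt (strictMono_iterPrime (k + 1) k.lt_succ_self)

lemma iterPrime_add (n m k : ℕ) : iterPrime n (m + k) = iterPrime (iterPrime n m) k := by
  induction k with
  | zero => rfl
  | succ k ih => exact congrArg nthPrime ih

lemma two_pow_lt_iterPrime_succ (n k : ℕ) : 2 ^ k < iterPrime n (k + 1) := by
  induction k with
  | zero =>
    have := Nat.add_two_le_nth_prime (n - 1)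
    change 1 < Nat.nth Nat.Prime (n - 1)
    omega
  | succ k ih =>
    have := two_mul_le_nthPrime_add_one (iterPrime n (k + 1))
    change 2 ^ (k + 1) < nthPrime (iterPrime n (k + 1))
    rw [pow_succ]
    omega

lemma iterPrime_diag_le (n k : ℕ) : iterPrime k k ≤ iterPrime n (Nat.log 2 k + 2 + k) := by
  rw [iterPrime_add]
  exact iterPrime_mono_left k
    ((Nat.lt_pow_succ_log_self one_lt_two k).trans (two_pow_lt_iterPrime_succ n _)).le

/-- For a strictly increasing sequence, `k` is at most the number of positive indices whose
value is at most `x` precisely when the `k`-th value is at most `x`. -/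
lemma StrictMono.le_ncard_iff {f : ℕ → ℕ} (hf : StrictMono f) {k : ℕ} (hk : 1 ≤ k) (x : ℝ) :
    k ≤ {j : ℕ | 1 ≤ j ∧ (f j : ℝ) ≤ x}.ncard ↔ (f k : ℝ) ≤ x := by
  constructor
  · intro h
    by_contra! hx
    have hsub : {j : ℕ | 1 ≤ j ∧ (f j : ℝ) ≤ x} ⊆ Finset.Icc 1 (k - 1) := by
      rintro j ⟨hj, hjx⟩
      have hlt : f j < f k := by exact_mod_cast hjx.trans_lt hx
      have := hf.lt_iff_lt.1 hlt
      simp only [Finset.coe_Icc, Set.mem_Icc]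
      omega
    have := Set.ncard_le_ncard hsub (Finset.finite_toSet _)
    rw [Set.ncard_coe_finset, Nat.card_Icc] at this
    omega
  · intro h
    have hfin : {j : ℕ | 1 ≤ j ∧ (f j : ℝ) ≤ x}.Finite :=
      (Set.finite_Iic ⌊x⌋₊).subset fun j hj =>
        (hf.id_le j).trans (Nat.le_floor hj.2)
    have hsub : (Finset.Icc 1 k : Set ℕ) ⊆ {j : ℕ | 1 ≤ j ∧ (f j : ℝ) ≤ x} := by
      intro j hj
      rw [Finset.coe_Icc, Set.mem_Icc] at hj
      exact ⟨hj.1, le_trans (by exact_mod_cast hf.monotone hj.2) h⟩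
    simpa [Set.ncard_coe_finset] using Set.ncard_le_ncard hsub hfin

lemma le_PnT_iff {n k : ℕ} (hk : 1 ≤ k) (x : ℝ) : k ≤ PnT n x ↔ (iterPrime n k : ℝ) ≤ x :=
  (strictMono_iterPrime n).le_ncard_iff hk x

lemma le_DiagP_iff {k : ℕ} (hk : 1 ≤ k) (x : ℝ) : k ≤ DiagP x ↔ (iterPrime k k : ℝ) ≤ x :=
  strictMono_iterPrime_diag.le_ncard_iff hk x

lemma tendsto_PnT_atTop (n : ℕ) : Tendsto (PnT n) atTop atTop := by
  refine tendsto_atTop.2 fun k => ?_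
  filter_upwards [eventually_ge_atTop (iterPrime n (k + 1) : ℝ)] with x hx
  exact k.le_succ.trans ((le_PnT_iff k.succ_pos x).2 hx)

lemma DiagP_le_PnT {n : ℕ} {x : ℝ} (hn : n ≤ PnT n x) : DiagP x ≤ PnT n x := by
  by_contra! h
  have hpos : 1 ≤ DiagP x := by omega
  have hle : (iterPrime n (DiagP x) : ℝ) ≤ x :=
    le_trans (by exact_mod_cast iterPrime_mono_left (DiagP x) (hn.trans h.le))
      ((le_DiagP_iff hpos x).1 le_rfl)
  exact h.not_ge ((le_PnT_iff hpos x).2 hle)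

lemma PnT_le_DiagP_add_log (n : ℕ) (x : ℝ) :
    PnT n x ≤ DiagP x + Nat.log 2 (DiagP x + 1) + 2 := by
  by_contra! h
  have hle : (iterPrime n (Nat.log 2 (DiagP x + 1) + 2 + (DiagP x + 1)) : ℝ) ≤ x :=
    (le_PnT_iff (by omega) x).1 (by omega)
  have hdiag : DiagP x + 1 ≤ DiagP x :=
    (le_DiagP_iff (by omega) x).2
      (le_trans (by exact_mod_cast iterPrime_diag_le n (DiagP x + 1)) hle)
  omega

lemma tendsto_natLog_add_div_atTop (c : ℝ) :
    Tendsto (fun N : ℕ => ((Nat.log 2 N : ℝ) + c) / N) atTop (nhds 0) := by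
  have hlog : Tendsto (fun N : ℕ => Real.logb 2 N / N) atTop (nhds 0) := by
    have h := (Real.isLittleO_log_id_atTop.tendsto_div_nhds_zero.comp
      (tendsto_natCast_atTop_atTop (R := ℝ))).div_const (Real.log 2)
    rw [zero_div] at h
    refine h.congr fun N => ?_
    simp only [Function.comp_apply, id, Real.logb]
    ring
  have hnat : Tendsto (fun N : ℕ => (Nat.log 2 N : ℝ) / N) atTop (nhds 0) :=
    squeeze_zero (fun N => by positivity)
      (fun N => div_le_div_of_nonneg_right (Real.natLog_le_logb N 2) N.cast_nonneg) hlog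
  simpa [add_div] using hnat.add (tendsto_const_div_atTop_nhds_zero_nat c)

theorem diagP_asymp_PnT (n : ℕ) (hn : 1 ≤ n) :
    Filter.Tendsto (fun x : ℝ => (DiagP x : ℝ) / (PnT n x : ℝ))
      Filter.atTop (nhds 1) := by
  have hlower : Tendsto (fun x => 1 - ((Nat.log 2 (PnT n x) : ℝ) + 3) / PnT n x)
      atTop (nhds 1) := by
    simpa using ((tendsto_natLog_add_div_atTop 3).comp (tendsto_PnT_atTop n)).const_sub 1
  refine tendsto_of_tendsto_of_tendsto_of_le_of_le' hlower tendsto_const_nhds ?_ ?_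
  · filter_upwards [(tendsto_PnT_atTop n).eventually_ge_atTop n] with x hx
    have hlog : Nat.log 2 (DiagP x + 1) ≤ Nat.log 2 (PnT n x) + 1 := by
      rw [← Nat.log_mul_base one_lt_two (by omega)]
      have := DiagP_le_PnT hx
      exact Nat.log_mono_right (by omega)
    have hle : PnT n x ≤ DiagP x + (Nat.log 2 (PnT n x) + 3) := by
      have := PnT_le_DiagP_add_log n x
      omega
    have hcast : (PnT n x : ℝ) ≤ DiagP x + (Nat.log 2 (PnT n x) + 3) := by exact_mod_cast hle
    have hpos : (0 : ℝ) < PnT n x := by exact_mod_cast hn.trans hx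
    rw [one_sub_div hpos.ne']
    gcongr
    linarith
  · filter_upwards [(tendsto_PnT_atTop n).eventually_ge_atTop n] with x hx
    exact div_le_one_of_le₀ (by exact_mod_cast DiagP_le_PnT hx) (Nat.cast_nonneg _)
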